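/- arXiv:0911.3051 — 8 statements merged into one kernel-verified Lean document; each statement's English description precedes it below -/
import Mathlib

section
/- Let K be a commutative ring and n ≥ 1. Let c : ℤ/2nℤ → K be a function. Suppose that for every r ∈ ℤ/2nℤ the product of n matrices η(c(r+n−1))·η(c(r+n−2))⋯η(c(r+1))·η(c(r)) equals −Id. Then c(r+n) = c(r) for all r ∈ ℤ/2nℤ. -/
/-- The matrix `η(x) = [[x, -1], [1, 0]]`. -/
def eta {K : Type*} [CommRing K] (x : K) : Matrix (Fin 2) (Fin 2) K :=
  !![x, -1; 1, 0]

/-- If every cyclic window of length `n` of the cyclic sequence `c` of Cartan entries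
has `η`-product (with leftmost factor `η(c (r+n-1))` and rightmost factor `η(c r)`)
equal to `-Id`, then the sequence is `n`-periodic. -/
theorem stmt_0 {K : Type*} [CommRing K] (n : ℕ) (hn : 1 ≤ n)
    (c : ZMod (2 * n) → K)
    (h : ∀ r : ZMod (2 * n),
      (((List.range n).map (fun k => eta (c (r + (k : ℕ))))).reverse).prod = -1) :
    ∀ r : ZMod (2 * n), c (r + (n : ZMod (2 * n))) = c r := by
  intro r
  have key := congrArg (fun l => (l.map fun k : ℕ => eta (c (r + (k : ℕ)))).reverse.prod)
    (List.range_succ (n := n).symm.trans List.range_succ_eq_map)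
  have hshift : ((List.range n).map ((fun k : ℕ => eta (c (r + (k : ℕ)))) ∘ Nat.succ)) =
      (List.range n).map (fun k => eta (c (r + 1 + (k : ℕ)))) :=
    List.map_congr_left fun k _ => by
      simp only [Function.comp_apply, Nat.cast_succ, add_assoc, add_comm (1 : ZMod (2 * n))]
  simp only [List.map_append, List.map_cons, List.map_nil, List.map_map, List.reverse_append,
    List.reverse_cons, List.reverse_nil, List.nil_append, List.prod_append, List.prod_singleton,
    hshift, h, Nat.cast_zero, add_zero, mul_neg, mul_one, neg_mul, one_mul, neg_inj] at key
  simpa [eta] using congrFun (congrFun key 0) 0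
end

section
/- For every n ≥ 3, the map sending a triangulation T of the labeled convex n-gon to the integer sequence (t_1,…,t_n), where t_i is the number of triangles of T containing vertex i, is a bijection from the set of triangulations of the n-gon onto the set of η-sequences of length n. -/
/-- η-sequences: generated from `(1,1,1)` by cyclic shifts, reversal and the
insertion rule `(c₁, c₂, c₃, …) ↦ (c₁+1, 1, c₂+1, c₃, …)`. -/
inductive IsEtaSeq : List ℤ → Prop
  | base : IsEtaSeq [1, 1, 1]
  | shift (c : ℤ) (l : List ℤ) : IsEtaSeq (c :: l) → IsEtaSeq (l ++ [c])
  | reverse (l : List ℤ) : IsEtaSeq l → IsEtaSeq l.reverse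
  | insert (c₁ c₂ : ℤ) (l : List ℤ) : IsEtaSeq (c₁ :: c₂ :: l) →
      IsEtaSeq ((c₁ + 1) :: 1 :: (c₂ + 1) :: l)

/-- A diagonal of the convex `n`-gon with vertices `0, 1, …, n-1` in cyclic order,
recorded as a pair `(p.1, p.2)` with `p.1 < p.2`: a pair of distinct non-adjacent
vertices. -/
def IsDiag (n : ℕ) (p : ℕ × ℕ) : Prop :=
  p.1 < p.2 ∧ p.2 < n ∧ p.1 + 2 ≤ p.2 ∧ ¬(p.1 = 0 ∧ p.2 = n - 1)

/-- Two diagonals (each recorded with increasing endpoints) cross iff exactly one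
endpoint of one lies strictly between the endpoints of the other in cyclic order. -/
def Cross (p q : ℕ × ℕ) : Prop :=
  (p.1 < q.1 ∧ q.1 < p.2 ∧ p.2 < q.2) ∨ (q.1 < p.1 ∧ p.1 < q.2 ∧ q.2 < p.2)

/-- A triangulation of the convex `n`-gon: a set of `n - 3` pairwise non-crossing
diagonals. -/
def IsTriangulation (n : ℕ) (T : Finset (ℕ × ℕ)) : Prop :=
  (∀ p ∈ T, IsDiag n p) ∧ T.card = n - 3 ∧ ∀ p ∈ T, ∀ q ∈ T, p ≠ q → ¬Cross p q

/-- `i < j` are joined by an edge of the triangulated polygon: either they are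
adjacent vertices of the `n`-gon, or `(i, j)` is a diagonal of `T`. -/
def EdgeOf (n : ℕ) (T : Finset (ℕ × ℕ)) (i j : ℕ) : Prop :=
  j = i + 1 ∨ (i = 0 ∧ j = n - 1) ∨ (i, j) ∈ T

/-- A triangle of the triangulation `T`: a 3-element set of vertices, any two of
which are adjacent in the `n`-gon or joined by a diagonal of `T`. -/
def IsTriangle (n : ℕ) (T : Finset (ℕ × ℕ)) (s : Finset ℕ) : Prop :=
  s.card = 3 ∧ (∀ i ∈ s, i < n) ∧ ∀ i ∈ s, ∀ j ∈ s, i < j → EdgeOf n T i j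

/-- The number of triangles of the triangulation `T` containing the vertex `i`. -/
noncomputable def vertexCount (n : ℕ) (T : Finset (ℕ × ℕ)) (i : ℕ) : ℕ :=
  {s : Finset ℕ | IsTriangle n T s ∧ i ∈ s}.ncard

/-- The order embedding of `ℕ` into itself that skips the value `u + 1`. -/
def skip (u x : ℕ) : ℕ := if x ≤ u then x else x + 1

/-- A left inverse of `skip u`. -/
def unskip (u x : ℕ) : ℕ := if x ≤ u then x else x - 1

/-- Relabelling of a pair of vertices by `skip u`. -/
def skipPair (u : ℕ) (p : ℕ × ℕ) : ℕ × ℕ := (skip u p.1, skip u p.2)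

/-- Glue an ear onto the side `{u, u + 1}`; the new vertex gets the label `u + 1`. -/
def addEar (u : ℕ) (T : Finset (ℕ × ℕ)) : Finset (ℕ × ℕ) :=
  insert (u, u + 2) (T.image (skipPair u))

/-- A set of pairwise non-crossing diagonals of the `n`-gon. -/
def NonCrossing (n : ℕ) (T : Finset (ℕ × ℕ)) : Prop :=
  (∀ p ∈ T, IsDiag n p) ∧ ∀ p ∈ T, ∀ q ∈ T, p ≠ q → ¬Cross p q

theorem skip_injective (u : ℕ) : Function.Injective (skip u) := by
  intro a b h
  grind [skip]

theorem skipPair_injective (u : ℕ) : Function.Injective (skipPair u) := by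
  rintro ⟨a, b⟩ ⟨c, d⟩ h
  simp only [skipPair, Prod.mk.injEq] at h ⊢
  exact ⟨skip_injective u h.1, skip_injective u h.2⟩

theorem skip_unskip {u x : ℕ} (h : x ≠ u + 1) : skip u (unskip u x) = x := by
  grind [skip, unskip]

theorem skip_ne (u x : ℕ) : skip u x ≠ u + 1 := by
  grind [skip]

theorem cross_skipPair {u : ℕ} {p q : ℕ × ℕ} :
    Cross (skipPair u p) (skipPair u q) ↔ Cross p q := by
  have h (a b : ℕ) : skip u a < skip u b ↔ a < b := by grind [skip]
  simp [Cross, skipPair, h]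

theorem ear_notMem_image (u : ℕ) {n : ℕ} {T : Finset (ℕ × ℕ)} (hT : ∀ p ∈ T, IsDiag n p) :
    (u, u + 2) ∉ T.image (skipPair u) := by
  simp only [Finset.mem_image, not_exists, not_and]
  intro p hp h
  have := hT p hp
  grind [IsDiag, skipPair, skip]

theorem NonCrossing.exists_image_eq {n u : ℕ} {S : Finset (ℕ × ℕ)} (hu : u + 1 < n)
    (hS : NonCrossing (n + 1) S) (hfree : ∀ p ∈ S, p.1 ≠ u + 1 ∧ p.2 ≠ u + 1) :
    ∃ S', NonCrossing n S' ∧ S'.image (skipPair u) = S.erase (u, u + 2) := by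
  have key : ∀ p ∈ S, skipPair u (unskip u p.1, unskip u p.2) = p := fun p hp => by
    simp [skipPair, skip_unskip (hfree p hp).1, skip_unskip (hfree p hp).2]
  refine ⟨(S.erase (u, u + 2)).image fun p => (unskip u p.1, unskip u p.2), ⟨?_, ?_⟩, ?_⟩
  · intro p hp
    obtain ⟨q, hq, rfl⟩ := Finset.mem_image.1 hp
    obtain ⟨hne, hqS⟩ := Finset.mem_erase.1 hq
    have h1 := hS.1 q hqS
    have h2 := hfree q hqS
    obtain ⟨a, b⟩ := q
    simp only [IsDiag, ne_eq, Prod.mk.injEq, unskip] at *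
    grind
  · intro p' hp' q' hq' hpq
    obtain ⟨p, hp, rfl⟩ := Finset.mem_image.1 hp'
    obtain ⟨q, hq, rfl⟩ := Finset.mem_image.1 hq'
    have hpS := Finset.mem_of_mem_erase hp
    have hqS := Finset.mem_of_mem_erase hq
    rw [← cross_skipPair (u := u), key p hpS, key q hqS]
    exact hS.2 p hpS q hqS fun h => hpq (by rw [h])
  · rw [Finset.image_image]
    ext p
    simp only [Finset.mem_image, Function.comp]
    constructor
    · rintro ⟨q, hq, rfl⟩
      rwa [key q (Finset.mem_of_mem_erase hq)]
    · exact fun hp => ⟨p, hp, key p (Finset.mem_of_mem_erase hp)⟩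

/-- A diagonal of minimal length cuts off a set of vertices not met by any diagonal. -/
theorem NonCrossing.exists_min {n : ℕ} {S : Finset (ℕ × ℕ)} (hS : NonCrossing n S)
    (hne : S.Nonempty) :
    ∃ q ∈ S, ∀ p ∈ S, p.1 ≠ q.1 + 1 ∧ p.2 ≠ q.1 + 1 := by
  obtain ⟨q, hq, hmin⟩ := Finset.exists_min_image S (fun p => p.2 - p.1) hne
  refine ⟨q, hq, fun p hp => ?_⟩
  have h1 := hmin p hp
  have h2 := hS.1 p hp
  have h3 := hS.1 q hq
  by_cases hpq : p = q
  · subst hpq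
    simp only [IsDiag] at *
    omega
  · have h4 := hS.2 p hp q hq hpq
    simp only [IsDiag, Cross] at *
    omega

theorem NonCrossing.card_le {n : ℕ} (hn : 3 ≤ n) :
    ∀ {S : Finset (ℕ × ℕ)}, NonCrossing n S →
      S.card ≤ n - 3 ∧ (4 ≤ n → S.card = n - 3 → ∃ u, u + 2 < n ∧ (u, u + 2) ∈ S) := by
  induction n, hn using Nat.le_induction with
  | base =>
    intro S hS
    refine ⟨?_, by omega⟩
    rw [Nat.sub_self, Nat.le_zero, Finset.card_eq_zero, Finset.eq_empty_iff_forall_notMem]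
    intro p hp
    have := hS.1 p hp
    simp only [IsDiag] at this
    omega
  | succ n hn ih =>
    intro S hS
    rcases S.eq_empty_or_nonempty with rfl | hne
    · simp only [Finset.card_empty]
      omega
    obtain ⟨⟨u, b⟩, hq, hfree⟩ := hS.exists_min hne
    have hd := hS.1 _ hq
    simp only [IsDiag] at hd
    obtain ⟨S', hS', himg⟩ := hS.exists_image_eq (u := u) (by omega) hfree
    have hc : S'.card = (S.erase (u, u + 2)).card := by
      rw [← himg, Finset.card_image_of_injective _ (skipPair_injective u)]
    have hle := (ih hS').1
    by_cases hm : (u, u + 2) ∈ S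
    · have hpos : 0 < S.card := Finset.card_pos.2 hne
      rw [Finset.card_erase_of_mem hm] at hc
      have := (hS.1 _ hm).2.1
      exact ⟨by omega, fun _ _ => ⟨u, this, hm⟩⟩
    · rw [Finset.erase_eq_of_notMem hm] at hc
      exact ⟨by omega, fun _ _ => by omega⟩

theorem isTriangulation_addEar {n u : ℕ} {T : Finset (ℕ × ℕ)} (hn : 3 ≤ n) (hu : u + 1 < n)
    (hT : IsTriangulation n T) : IsTriangulation (n + 1) (addEar u T) := by
  obtain ⟨hd, hc, hx⟩ := hT
  refine ⟨?_, ?_, ?_⟩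
  · intro p hp
    rcases Finset.mem_insert.1 hp with rfl | hp
    · simp only [IsDiag]
      omega
    · obtain ⟨q, hq, rfl⟩ := Finset.mem_image.1 hp
      have := hd q hq
      grind [IsDiag, skipPair, skip]
  · rw [addEar, Finset.card_insert_of_notMem (ear_notMem_image u hd),
      Finset.card_image_of_injective _ (skipPair_injective u)]
    omega
  · intro p hp q hq hpq
    rcases Finset.mem_insert.1 hp with rfl | hp <;> rcases Finset.mem_insert.1 hq with rfl | hq
    · exact absurd rfl hpq
    · obtain ⟨q, -, rfl⟩ := Finset.mem_image.1 hq
      simp only [Cross, skipPair]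
      grind [skip_ne]
    · obtain ⟨p, -, rfl⟩ := Finset.mem_image.1 hp
      simp only [Cross, skipPair]
      grind [skip_ne]
    · obtain ⟨p, hpT, rfl⟩ := Finset.mem_image.1 hp
      obtain ⟨q, hqT, rfl⟩ := Finset.mem_image.1 hq
      rw [cross_skipPair]
      exact hx p hpT q hqT fun h => hpq (by rw [h])

theorem IsTriangulation.exists_eq_addEar {n u : ℕ} {S : Finset (ℕ × ℕ)} (hn : 3 ≤ n)
    (hS : IsTriangulation (n + 1) S) (hu : (u, u + 2) ∈ S) :
    ∃ T, IsTriangulation n T ∧ S = addEar u T := by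
  obtain ⟨hd, hc, hx⟩ := hS
  have hun := (hd _ hu).2.1
  have hfree : ∀ p ∈ S, p.1 ≠ u + 1 ∧ p.2 ≠ u + 1 := fun p hp => by
    have h1 := hd p hp
    by_cases h : p = (u, u + 2)
    · subst h
      simp
    · have h2 := hx p hp _ hu h
      simp only [IsDiag, Cross] at *
      omega
  obtain ⟨T, hT, himg⟩ := NonCrossing.exists_image_eq (Nat.lt_of_succ_lt_succ hun) ⟨hd, hx⟩ hfree
  refine ⟨T, ⟨hT.1, ?_, hT.2⟩, by rw [addEar, himg, Finset.insert_erase hu]⟩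
  rw [← Finset.card_image_of_injective T (skipPair_injective u), himg,
    Finset.card_erase_of_mem hu]
  omega

theorem isTriangulation_three {T : Finset (ℕ × ℕ)} : IsTriangulation 3 T ↔ T = ∅ := by
  constructor
  · exact fun h => Finset.card_eq_zero.1 h.2.1
  · rintro rfl
    simp [IsTriangulation]

theorem IsTriangulation.exists_ear {n : ℕ} {S : Finset (ℕ × ℕ)} (hn : 3 ≤ n)
    (hS : IsTriangulation (n + 1) S) : ∃ u, u + 1 < n ∧ (u, u + 2) ∈ S := by
  obtain ⟨u, hu, h⟩ := (NonCrossing.card_le (by omega) ⟨hS.1, hS.2.2⟩).2 (by omega) hS.2.1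
  exact ⟨u, by omega, h⟩

/-- Every triangulation arises from the triangle by repeatedly gluing ears. -/
theorem IsTriangulation.induction {motive : ℕ → Finset (ℕ × ℕ) → Prop} (triangle : motive 3 ∅)
    (ear : ∀ n u T, 3 ≤ n → u + 1 < n → IsTriangulation n T → motive n T →
      motive (n + 1) (addEar u T))
    {n : ℕ} (hn : 3 ≤ n) : ∀ {T}, IsTriangulation n T → motive n T := by
  induction n, hn using Nat.le_induction with
  | base =>
    intro T hT
    rwa [isTriangulation_three.1 hT]
  | succ n hn ih =>
    intro S hS
    obtain ⟨u, hu, hmem⟩ := hS.exists_ear hn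
    obtain ⟨T, hT, rfl⟩ := hS.exists_eq_addEar hn hmem
    exact ear n u T hn hu hT (ih hT)

theorem edgeOf_addEar_skip {n u i j : ℕ} {T : Finset (ℕ × ℕ)} (hu : u + 1 < n) (hij : i < j) :
    EdgeOf (n + 1) (addEar u T) (skip u i) (skip u j) ↔ EdgeOf n T i j := by
  have hmem : (skip u i, skip u j) ∈ T.image (skipPair u) ↔ (i, j) ∈ T :=
    (skipPair_injective u).mem_finset_image (a := (i, j))
  simp only [EdgeOf, addEar, Finset.mem_insert, hmem, Prod.mk.injEq, Nat.add_sub_cancel]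
  by_cases h : (i, j) ∈ T
  · simp [h]
  · simp only [h, or_false, skip]
    grind

theorem edgeOf_addEar_left {n u j : ℕ} {T : Finset (ℕ × ℕ)}
    (h : EdgeOf (n + 1) (addEar u T) (u + 1) j) : j = u + 2 := by
  simp only [EdgeOf, addEar, Finset.mem_insert, Finset.mem_image, skipPair, Prod.mk.injEq] at h
  grind [skip_ne]

theorem edgeOf_addEar_right {n u i : ℕ} {T : Finset (ℕ × ℕ)} (hu : u + 1 < n)
    (h : EdgeOf (n + 1) (addEar u T) i (u + 1)) : i = u := by
  simp only [EdgeOf, addEar, Finset.mem_insert, Finset.mem_image, skipPair, Prod.mk.injEq] at h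
  grind [skip_ne]

theorem isTriangle_addEar {n u : ℕ} {T : Finset (ℕ × ℕ)} (hu : u + 1 < n) {s : Finset ℕ} :
    IsTriangle (n + 1) (addEar u T) s ↔
      s = {u, u + 1, u + 2} ∨ ∃ t, IsTriangle n T t ∧ t.image (skip u) = s := by
  constructor
  · rintro ⟨hc, hlt, hedge⟩
    by_cases hmem : u + 1 ∈ s
    · left
      refine Finset.eq_of_subset_of_card_le (fun x hx => ?_) ?_
      · rcases lt_trichotomy x (u + 1) with h | rfl | h
        · simp [edgeOf_addEar_right hu (hedge x hx _ hmem h)]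
        · simp
        · simp [edgeOf_addEar_left (hedge _ hmem x hx h)]
      · rw [hc]
        exact Finset.card_le_three
    · right
      have himg : (s.image (unskip u)).image (skip u) = s := by
        rw [Finset.image_image]
        conv_rhs => rw [← Finset.image_id (s := s)]
        refine Finset.image_congr fun x hx => ?_
        exact skip_unskip fun h => hmem (h ▸ hx)
      refine ⟨s.image (unskip u), ⟨?_, ?_, ?_⟩, himg⟩
      · rw [← Finset.card_image_of_injective _ (skip_injective u), himg, hc]
      · intro i hi
        have := hlt _ (himg ▸ Finset.mem_image_of_mem (skip u) hi)
        grind [skip]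
      · intro i hi j hj hij
        have h1 := himg ▸ Finset.mem_image_of_mem (skip u) hi
        have h2 := himg ▸ Finset.mem_image_of_mem (skip u) hj
        exact (edgeOf_addEar_skip hu hij).1 (hedge _ h1 _ h2 (by grind [skip]))
  · rintro (rfl | ⟨t, ⟨hc, hlt, hedge⟩, rfl⟩)
    · refine ⟨by simp, by simp; omega, ?_⟩
      simp only [Finset.mem_insert, Finset.mem_singleton, EdgeOf, addEar, Prod.mk.injEq]
      rintro i (rfl | rfl | rfl) j (rfl | rfl | rfl) hij <;> grind
    · refine ⟨by rw [Finset.card_image_of_injective _ (skip_injective u), hc], ?_, ?_⟩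
      · simp only [Finset.mem_image, forall_exists_index, and_imp, forall_apply_eq_imp_iff₂]
        intro i hi
        have := hlt i hi
        grind [skip]
      · simp only [Finset.mem_image, forall_exists_index, and_imp, forall_apply_eq_imp_iff₂]
        intro i hi j hj hij
        have hij : i < j := by grind [skip]
        exact (edgeOf_addEar_skip hu hij).2 (hedge i hi j hj hij)

theorem finite_setOf_isTriangle (n : ℕ) (T : Finset (ℕ × ℕ)) (i : ℕ) :
    {s | IsTriangle n T s ∧ i ∈ s}.Finite :=
  (Finset.finite_toSet (Finset.range n).powerset).subset fun s hs => by
    simp only [Finset.coe_powerset, Set.mem_preimage, Set.mem_powerset_iff, Finset.coe_subset]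
    exact fun i hi => Finset.mem_range.2 (hs.1.2.1 i hi)

theorem vertexCount_addEar_tip {n u : ℕ} {T : Finset (ℕ × ℕ)} (hu : u + 1 < n) :
    vertexCount (n + 1) (addEar u T) (u + 1) = 1 := by
  rw [vertexCount, Set.ncard_eq_one]
  refine ⟨{u, u + 1, u + 2}, Set.ext fun s => ?_⟩
  simp only [isTriangle_addEar hu, Set.mem_ofPred_eq, Set.mem_singleton_iff]
  constructor
  · rintro ⟨rfl | ⟨t, -, rfl⟩, h⟩
    · rfl
    · obtain ⟨x, -, hx⟩ := Finset.mem_image.1 h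
      exact absurd hx (skip_ne u x)
  · rintro rfl
    simp

theorem vertexCount_addEar_skip {n u : ℕ} {T : Finset (ℕ × ℕ)} (hu : u + 1 < n) (j : ℕ) :
    vertexCount (n + 1) (addEar u T) (skip u j) =
      vertexCount n T j + if j = u ∨ j = u + 1 then 1 else 0 := by
  have hinj : Function.Injective (Finset.image (skip u)) :=
    Finset.image_injective (skip_injective u)
  have himg : ((Finset.image (skip u)) '' {t | IsTriangle n T t ∧ j ∈ t}).ncard =
      vertexCount n T j := Set.ncard_image_of_injective _ hinj
  have hmem : skip u j ∈ ({u, u + 1, u + 2} : Finset ℕ) ↔ j = u ∨ j = u + 1 := by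
    simp only [Finset.mem_insert, Finset.mem_singleton, skip]
    split_ifs <;> omega
  split_ifs with h
  · rw [← himg, ← Set.ncard_insert_of_notMem (a := ({u, u + 1, u + 2} : Finset ℕ)) ?_
      ((finite_setOf_isTriangle n T j).image _), vertexCount]
    · congr 1
      ext s
      simp only [isTriangle_addEar hu, Set.mem_ofPred_eq, Set.mem_insert_iff, Set.mem_image]
      constructor
      · rintro ⟨rfl | ⟨t, ht, rfl⟩, hs⟩
        · exact Or.inl rfl
        · exact Or.inr ⟨t, ⟨ht, ((skip_injective u).mem_finset_image).1 hs⟩, rfl⟩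
      · rintro (rfl | ⟨t, ⟨ht, hj⟩, rfl⟩)
        · exact ⟨Or.inl rfl, hmem.2 h⟩
        · exact ⟨Or.inr ⟨t, ht, rfl⟩, Finset.mem_image_of_mem _ hj⟩
    · rintro ⟨t, -, ht⟩
      have : u + 1 ∈ t.image (skip u) := by
        rw [ht]
        simp
      obtain ⟨x, -, hx⟩ := Finset.mem_image.1 this
      exact skip_ne u x hx
  · rw [add_zero, ← himg, vertexCount]
    congr 1
    ext s
    simp only [isTriangle_addEar hu, Set.mem_ofPred_eq, Set.mem_image]
    constructor
    · rintro ⟨rfl | ⟨t, ht, rfl⟩, hs⟩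
      · exact absurd (hmem.1 hs) h
      · exact ⟨t, ⟨ht, ((skip_injective u).mem_finset_image).1 hs⟩, rfl⟩
    · rintro ⟨t, ⟨ht, hj⟩, rfl⟩
      exact ⟨Or.inr ⟨t, ht, rfl⟩, Finset.mem_image_of_mem _ hj⟩

theorem vertexCount_triangle {i : ℕ} (hi : i < 3) : vertexCount 3 ∅ i = 1 := by
  rw [vertexCount, Set.ncard_eq_one]
  refine ⟨{0, 1, 2}, Set.ext fun s => ?_⟩
  simp only [Set.mem_ofPred_eq, Set.mem_singleton_iff]
  constructor
  · rintro ⟨⟨hc, hlt, -⟩, -⟩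
    refine Finset.eq_of_subset_of_card_le (fun x hx => ?_) (by rw [hc]; exact Finset.card_le_three)
    have := hlt x hx
    simp only [Finset.mem_insert, Finset.mem_singleton]
    omega
  · rintro rfl
    refine ⟨⟨rfl, by simp, ?_⟩, ?_⟩
    · simp only [Finset.mem_insert, Finset.mem_singleton, EdgeOf]
      omega
    · simp only [Finset.mem_insert, Finset.mem_singleton]
      omega

theorem IsTriangulation.vertexCount_pos {n : ℕ} {T : Finset (ℕ × ℕ)} (hn : 3 ≤ n)
    (hT : IsTriangulation n T) : ∀ {i}, i < n → 0 < vertexCount n T i := by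
  refine IsTriangulation.induction
    (motive := fun n T => ∀ {i}, i < n → 0 < vertexCount n T i) ?_ ?_ hn hT
  · intro i hi
    simp [vertexCount_triangle hi]
  · intro n u T hn hu hT ih i hi
    by_cases h : i = u + 1
    · simp [h, vertexCount_addEar_tip hu]
    · rw [← skip_unskip h, vertexCount_addEar_skip hu]
      have := ih (i := unskip u i) (by grind [unskip])
      omega

theorem IsTriangulation.ear_mem_of_vertexCount_eq_one {n : ℕ} {T : Finset (ℕ × ℕ)} (hn : 3 ≤ n)
    (hT : IsTriangulation n T) : ∀ {v}, 4 ≤ n → v + 2 < n → vertexCount n T (v + 1) = 1 →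
      (v, v + 2) ∈ T := by
  refine IsTriangulation.induction (motive := fun n T => ∀ {v}, 4 ≤ n → v + 2 < n →
    vertexCount n T (v + 1) = 1 → (v, v + 2) ∈ T) (by simp) ?_ hn hT
  intro n u T hn hu hT ih v _ hv hcount
  by_cases hvu : v = u
  · simp [addEar, hvu]
  rw [← skip_unskip (u := u) (x := v + 1) (by omega), vertexCount_addEar_skip hu] at hcount
  have hpos := hT.vertexCount_pos hn (i := unskip u (v + 1)) (by grind [unskip])
  have hfar : ¬(unskip u (v + 1) = u ∨ unskip u (v + 1) = u + 1) := fun h => by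
    rw [if_pos h] at hcount
    omega
  rw [if_neg hfar, add_zero] at hcount
  obtain ⟨w, hw⟩ : ∃ w, unskip u (v + 1) = w + 1 :=
    ⟨unskip u (v + 1) - 1, by grind [unskip]⟩
  rw [hw] at hcount
  have := ih (v := w) (by grind [unskip]) (by grind [unskip]) hcount
  refine Finset.mem_insert_of_mem (Finset.mem_image.2 ⟨_, this, ?_⟩)
  grind [skipPair, skip, unskip]

theorem IsTriangulation.eq_of_vertexCount_eq {n : ℕ} (hn : 3 ≤ n) :
    ∀ {S T : Finset (ℕ × ℕ)}, IsTriangulation n S → IsTriangulation n T →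
      (∀ i < n, vertexCount n S i = vertexCount n T i) → S = T := by
  induction n, hn using Nat.le_induction with
  | base =>
    intro S T hS hT _
    rw [isTriangulation_three.1 hS, isTriangulation_three.1 hT]
  | succ n hn ih =>
    intro S T hS hT h
    obtain ⟨u, hu, hmem⟩ := hS.exists_ear hn
    obtain ⟨S', hS', rfl⟩ := hS.exists_eq_addEar hn hmem
    have hcount := h (u + 1) (by omega)
    rw [vertexCount_addEar_tip hu] at hcount
    have hmemT := hT.ear_mem_of_vertexCount_eq_one (by omega) (by omega) (by omega) hcount.symm
    obtain ⟨T', hT', rfl⟩ := hT.exists_eq_addEar hn hmemT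
    rw [ih hS' hT' fun i hi => ?_]
    have := h (skip u i) (by grind [skip])
    rw [vertexCount_addEar_skip hu, vertexCount_addEar_skip hu] at this
    omega

/-- The sequences obtained from `(1, 1, 1)` by insertions between consecutive entries. -/
inductive IsEarSeq : List ℤ → Prop
  | base : IsEarSeq [1, 1, 1]
  | insert (l : List ℤ) (a b : ℤ) (r : List ℤ) : IsEarSeq (l ++ a :: b :: r) →
      IsEarSeq (l ++ (a + 1) :: 1 :: (b + 1) :: r)

theorem IsEarSeq.reverse {l : List ℤ} (h : IsEarSeq l) : IsEarSeq l.reverse := by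
  induction h with
  | base => exact base
  | insert l a b r _ ih =>
    have := insert r.reverse b a l.reverse (by simpa using ih)
    simpa using this

theorem IsEarSeq.three_le_length {l : List ℤ} (h : IsEarSeq l) : 3 ≤ l.length := by
  induction h with
  | base => simp
  | insert l a b r _ ih =>
    simp only [List.length_append, List.length_cons] at *
    omega

/-- Insertion between the last and the first entry. -/
theorem IsEarSeq.insert_wrap {L : List ℤ} (h : IsEarSeq L) :
    ∀ {b : ℤ} {m : List ℤ} {a : ℤ}, L = b :: (m ++ [a]) →
      IsEarSeq (1 :: (b + 1) :: (m ++ [a + 1])) := by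
  induction h with
  | base =>
    intro b m a h
    obtain ⟨rfl, h'⟩ := List.cons.inj h
    obtain ⟨rfl, h⟩ := List.append_inj' (s₁ := [1]) (s₂ := m) (t₁ := [1]) (t₂ := [a]) h' rfl
    obtain rfl : (1 : ℤ) = a := by simpa using h
    exact insert [1] 1 1 [] base
  | insert l x y r hprev ih =>
    intro b m a h
    have hlen := hprev.three_le_length
    rcases l with _ | ⟨c, l⟩ <;> rcases r.eq_nil_or_concat with rfl | ⟨r, d, rfl⟩
    · simp at hlen
    · obtain ⟨rfl, h⟩ := List.cons.inj h
      obtain ⟨rfl, h⟩ := List.append_inj' (s₁ := 1 :: (y + 1) :: r) (s₂ := m) (t₁ := [d]) (t₂ := [a])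
        (by simpa using h) rfl
      obtain rfl : d = a := by simpa using h
      have := ih (b := x) (m := y :: r) (a := d) (by simp)
      simpa using insert [1] (x + 1) y (r ++ [d + 1]) (by simpa using this)
    · obtain ⟨rfl, h⟩ := List.cons.inj h
      obtain ⟨rfl, h⟩ := List.append_inj' (s₁ := l ++ [x + 1, 1]) (s₂ := m) (t₁ := [y + 1]) (t₂ := [a])
        (by simpa using h) rfl
      obtain rfl : y + 1 = a := by simpa using h
      have := ih (b := c) (m := l ++ [x]) (a := y) (by simp)
      simpa using insert (1 :: (c + 1) :: l) x (y + 1) [] (by simpa using this)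
    · obtain ⟨rfl, h⟩ := List.cons.inj h
      obtain ⟨rfl, h⟩ := List.append_inj' (s₁ := l ++ (x + 1) :: 1 :: (y + 1) :: r)
        (s₂ := m) (t₁ := [d]) (t₂ := [a]) (by simpa using h) rfl
      obtain rfl : d = a := by simpa using h
      have := ih (b := c) (m := l ++ x :: y :: r) (a := d) (by simp)
      simpa using insert (1 :: (c + 1) :: l) x y (r ++ [d + 1]) (by simpa using this)

theorem IsEarSeq.shift {L : List ℤ} (h : IsEarSeq L) :
    ∀ {c : ℤ} {l : List ℤ}, L = c :: l → IsEarSeq (l ++ [c]) := by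
  induction h with
  | base =>
    rintro c l h
    obtain ⟨rfl, rfl⟩ := List.cons.inj h
    exact base
  | insert l a b r _ ih =>
    intro c m h
    rcases l with _ | ⟨d, l⟩
    · obtain ⟨rfl, rfl⟩ := List.cons.inj h
      exact insert_wrap (ih rfl) rfl
    · obtain ⟨rfl, rfl⟩ := List.cons.inj h
      simpa using insert l a b (r ++ [d]) (by simpa using ih rfl)

theorem IsEtaSeq.rotate {l : List ℤ} : ∀ {m : List ℤ}, IsEtaSeq (l ++ m) → IsEtaSeq (m ++ l) := by
  induction l with
  | nil => simp
  | cons c l ih =>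
    intro m h
    have := shift c (l ++ m) h
    simpa using ih (m := m ++ [c]) (by simpa using this)

theorem isEtaSeq_iff_isEarSeq {l : List ℤ} : IsEtaSeq l ↔ IsEarSeq l := by
  constructor <;> intro h
  · induction h with
    | base => exact .base
    | shift c l _ ih => exact ih.shift rfl
    | reverse l _ ih => exact ih.reverse
    | insert a b l _ ih => exact .insert [] a b l ih
  · induction h with
    | base => exact .base
    | insert l a b r _ ih =>
      exact IsEtaSeq.rotate (l := (a + 1) :: 1 :: (b + 1) :: r)
        (.insert a b (r ++ l) (IsEtaSeq.rotate ih))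

/-- The sequence of vertex counts of `T`. -/
noncomputable def quiddity (n : ℕ) (T : Finset (ℕ × ℕ)) : List ℤ :=
  List.ofFn fun i : Fin n => (vertexCount n T i : ℤ)

theorem quiddity_triangle : quiddity 3 ∅ = [1, 1, 1] := by
  simp [quiddity, vertexCount_triangle]

theorem quiddity_addEar {n : ℕ} {T : Finset (ℕ × ℕ)} {l r : List ℤ} {a b : ℤ}
    (h : quiddity n T = l ++ a :: b :: r) :
    quiddity (n + 1) (addEar l.length T) = l ++ (a + 1) :: 1 :: (b + 1) :: r := by
  have hlen : n = l.length + (r.length + 2) := by simpa [quiddity] using congrArg List.length h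
  have hu : l.length + 1 < n := by omega
  have hval (i : ℕ) (hi : i < n) :
      (vertexCount n T i : ℤ) = (l ++ a :: b :: r)[i]'(by simp; omega) := by
    simp [← h, quiddity]
  refine List.ext_getElem (by simp [quiddity]; omega) fun i hi _ => ?_
  simp only [quiddity, List.length_ofFn, List.getElem_ofFn] at hi ⊢
  by_cases hiu : i = l.length + 1
  · subst hiu
    rw [vertexCount_addEar_tip hu]
    simp
  · rw [← congrArg (vertexCount (n + 1) _) (skip_unskip hiu), vertexCount_addEar_skip hu]
    push_cast
    rw [hval _ (by grind [unskip])]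
    grind [unskip]

theorem IsTriangulation.isEarSeq_quiddity {n : ℕ} {T : Finset (ℕ × ℕ)} (hn : 3 ≤ n)
    (hT : IsTriangulation n T) : IsEarSeq (quiddity n T) := by
  refine IsTriangulation.induction (motive := fun n T => IsEarSeq (quiddity n T)) ?_ ?_ hn hT
  · rw [quiddity_triangle]
    exact .base
  · intro n u T hn hu hT ih
    have hlen : (quiddity n T).length = n := by simp [quiddity]
    have hsplit : quiddity n T = (quiddity n T).take u ++
        (quiddity n T)[u] :: (quiddity n T)[u + 1] :: (quiddity n T).drop (u + 2) := by
      simp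
    have htake : ((quiddity n T).take u).length = u := by
      rw [List.length_take]
      omega
    have := quiddity_addEar hsplit
    rw [htake] at this
    rw [this]
    exact .insert _ _ _ _ (hsplit ▸ ih)

theorem IsEarSeq.exists_quiddity_eq {l : List ℤ} (h : IsEarSeq l) :
    ∃ T, IsTriangulation l.length T ∧ quiddity l.length T = l := by
  induction h with
  | base => exact ⟨∅, isTriangulation_three.2 rfl, quiddity_triangle⟩
  | insert l a b r hprev ih =>
    obtain ⟨T, hT, hq⟩ := ih
    have hlen : (l ++ (a + 1) :: 1 :: (b + 1) :: r).length = (l ++ a :: b :: r).length + 1 := by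
      simp
      omega
    rw [hlen]
    exact ⟨addEar l.length T, isTriangulation_addEar hprev.three_le_length (by simp) hT,
      quiddity_addEar hq⟩

/-- The map sending a triangulation `T` of the labeled convex `n`-gon to the sequence
`(t_1, …, t_n)`, where `t_i` is the number of triangles of `T` containing vertex `i`,
is a bijection from the set of triangulations of the `n`-gon onto the set of
η-sequences of length `n`. -/
theorem stmt_2 (n : ℕ) (hn : 3 ≤ n) :
    Set.BijOn (fun T => List.ofFn (fun i : Fin n => (vertexCount n T i : ℤ)))
      {T | IsTriangulation n T} {l : List ℤ | IsEtaSeq l ∧ l.length = n} := by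
  refine ⟨fun T hT => ⟨?_, by simp⟩, fun S hS T hT h => ?_, ?_⟩
  · exact isEtaSeq_iff_isEarSeq.2 (IsTriangulation.isEarSeq_quiddity hn hT)
  · refine IsTriangulation.eq_of_vertexCount_eq hn hS hT fun i hi => ?_
    exact_mod_cast congrFun (List.ofFn_injective h) ⟨i, hi⟩
  · rintro l ⟨hl, rfl⟩
    exact (isEtaSeq_iff_isEarSeq.1 hl).exists_quiddity_eq
end

section
/- If (v_1,…,v_m) is an ℰ-sequence and 1 < i < m, then there exist indices 1 ≤ j, k ≤ m such that v_i = v_j + v_k. (Equivalently, every positive root of a finite rank-two root system of a Cartan scheme is either simple or the sum of two positive roots at the same object, the positive roots being exactly the entries of an ℰ-sequence, whose first and last entries are the simple roots (0,1) and (1,0).) -/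
/-- ℰ-sequences: generated from `((0,1),(1,1),(1,0))` by inserting the sum of two
consecutive entries between them. -/
inductive IsESeq : List (ℕ × ℕ) → Prop
  | base : IsESeq [(0, 1), (1, 1), (1, 0)]
  | step (l₁ l₂ : List (ℕ × ℕ)) (v w : ℕ × ℕ) :
      IsESeq (l₁ ++ v :: w :: l₂) → IsESeq (l₁ ++ v :: (v + w) :: w :: l₂)

theorem IsESeq.exists_add_of_inner {l : List (ℕ × ℕ)} (h : IsESeq l) :
    ∀ (i : ℕ) (hi : i + 1 < l.length), 0 < i → ∃ a ∈ l, ∃ b ∈ l, l[i] = a + b := by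
  induction h with
  | base =>
    intro i hi hpos
    obtain rfl : i = 1 := by simp at hi; omega
    exact ⟨(0, 1), by simp, (1, 0), by simp, rfl⟩
  | step l₁ l₂ v w _ ih =>
    have hmem : ∀ x ∈ l₁ ++ v :: w :: l₂, x ∈ l₁ ++ v :: (v + w) :: w :: l₂ := by
      intro x hx
      simp only [List.mem_append, List.mem_cons] at hx ⊢
      tauto
    intro i hi hpos
    have hlen : i < l₁.length + l₂.length + 2 := by simp at hi; omega
    rcases lt_trichotomy i (l₁.length + 1) with hlt | rfl | hgt
    · obtain ⟨a, ha, b, hb, hab⟩ := ih i (by simp; omega) hpos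
      exact ⟨a, hmem a ha, b, hmem b hb, by rw [← hab]; grind⟩
    · exact ⟨v, by simp, w, by simp, by simp⟩
    · obtain ⟨j, rfl⟩ : ∃ j, i = j + 1 := ⟨i - 1, by omega⟩
      obtain ⟨a, ha, b, hb, hab⟩ := ih j (by simp; omega) (by omega)
      exact ⟨a, hmem a ha, b, hmem b hb, by rw [← hab]; grind⟩

/-- Every entry of an ℰ-sequence other than the first and the last one is the sum of
two entries of the sequence. -/
theorem stmt_4 (l : List (ℕ × ℕ)) (h : IsESeq l) (i : Fin l.length)
    (h1 : 0 < (i : ℕ)) (h2 : (i : ℕ) + 1 < l.length) :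
    ∃ j k : Fin l.length, l.get i = l.get j + l.get k := by
  obtain ⟨a, ha, b, hb, hab⟩ := h.exists_add_of_inner i h2 h1
  obtain ⟨j, rfl⟩ := List.get_of_mem ha
  obtain ⟨k, rfl⟩ := List.get_of_mem hb
  exact ⟨j, k, hab⟩
end

section
/- Let d = (a_1,…,a_m) be a finite sequence of positive integers with m ≥ 1, and let r ≥ 1. If the r-fold concatenation d^r = (a_1,…,a_m,a_1,…,a_m,…,a_1,…,a_m) is an η-sequence, then r ∈ {1, 2, 3}. -/
open Matrix

/-- The matrix `[[c, -1], [1, 0]]` reduced modulo `3`. -/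
def etaMatrix (c : ℤ) : Matrix (Fin 2) (Fin 2) (ZMod 3) := !![(c : ZMod 3), -1; 1, 0]

theorem etaMatrix_conj_transpose (c : ℤ) :
    !![1, 0; 0, -1] * (etaMatrix c)ᵀ * !![1, 0; 0, -1] = etaMatrix c := by
  ext i j
  fin_cases i <;> fin_cases j <;>
    simp [etaMatrix, Matrix.mul_apply, Fin.sum_univ_two, -Matrix.cons_mul]

theorem prod_map_etaMatrix_reverse (l : List ℤ) :
    (l.reverse.map etaMatrix).prod =
      !![1, 0; 0, -1] * (l.map etaMatrix).prodᵀ * !![1, 0; 0, -1] := by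
  have hJ : (!![1, 0; 0, -1] : Matrix (Fin 2) (Fin 2) (ZMod 3)) * !![1, 0; 0, -1] = 1 := by
    simp [Matrix.one_fin_two]
  induction l with
  | nil => simp [hJ, -Matrix.cons_mul]
  | cons c l ih =>
    rw [List.reverse_cons, List.map_append, List.prod_append, ih, List.map_singleton,
      List.prod_singleton, List.map_cons, List.prod_cons, Matrix.transpose_mul]
    nth_rewrite 1 [← etaMatrix_conj_transpose c]
    simp only [Matrix.mul_assoc]
    rw [← Matrix.mul_assoc !![1, 0; 0, -1] !![1, 0; 0, -1], hJ, Matrix.one_mul]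

theorem etaMatrix_insert (a b : ℤ) :
    etaMatrix (a + 1) * (etaMatrix 1 * etaMatrix (b + 1)) = etaMatrix a * etaMatrix b := by
  ext i j
  fin_cases i <;> fin_cases j <;> simp [etaMatrix, Matrix.mul_apply, Fin.sum_univ_two]; ring

theorem IsEtaSeq.prod_map_etaMatrix {l : List ℤ} (h : IsEtaSeq l) :
    (l.map etaMatrix).prod = -1 := by
  induction h with
  | base => decide
  | shift c l _ ih =>
    rw [List.map_cons, List.prod_cons, ← neg_eq_iff_eq_neg, ← Matrix.neg_mul,
      mul_eq_one_comm, Matrix.mul_neg, neg_eq_iff_eq_neg] at ih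
    simpa using ih
  | reverse l _ ih =>
    rw [prod_map_etaMatrix_reverse, ih]
    decide
  | insert a b l _ ih =>
    rw [← ih]
    simp only [List.map_cons, List.prod_cons, ← mul_assoc, ← etaMatrix_insert a b]

theorem IsEtaSeq.sum_add_six {l : List ℤ} (h : IsEtaSeq l) : l.sum + 6 = 3 * l.length := by
  induction h <;> simp_all <;> linarith

/-- On matrices of determinant one, this is the homomorphism `SL₂(𝔽₃) → 𝔽₃`. -/
def slTwoCharacter (A : Matrix (Fin 2) (Fin 2) (ZMod 3)) : ZMod 3 :=
  (1 - A 1 0 ^ 2) * (A 0 1 * A 1 1) + A 1 0 * (A 0 0 + A 1 1)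

theorem slTwoCharacter_etaMatrix_mul (c : ℤ) (A : Matrix (Fin 2) (Fin 2) (ZMod 3))
    (hA : A.det = 1) : slTwoCharacter (etaMatrix c * A) = c + slTwoCharacter A := by
  rw [Matrix.det_fin_two] at hA
  simp only [slTwoCharacter, etaMatrix, Matrix.mul_apply, Fin.sum_univ_two, Matrix.of_apply,
    Matrix.cons_val', Matrix.cons_val_zero, Matrix.cons_val_one, Matrix.cons_val_fin_one]
  generalize (c : ZMod 3) = x at *
  generalize A 0 0 = p at *
  generalize A 0 1 = q at *
  generalize A 1 0 = s at *
  generalize A 1 1 = t at *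
  revert x p q s t
  decide

theorem det_etaMatrix (c : ℤ) : (etaMatrix c).det = 1 := by
  simp [etaMatrix, Matrix.det_fin_two]

theorem det_prod_map_etaMatrix (l : List ℤ) : (l.map etaMatrix).prod.det = 1 := by
  induction l with
  | nil => simp
  | cons c l ih => simp [det_etaMatrix, ih]

theorem slTwoCharacter_prod_map_etaMatrix (l : List ℤ) :
    slTwoCharacter (l.map etaMatrix).prod = (l.sum : ZMod 3) := by
  induction l with
  | nil => simp [slTwoCharacter]
  | cons c l ih =>
    rw [List.map_cons, List.prod_cons,
      slTwoCharacter_etaMatrix_mul c _ (det_prod_map_etaMatrix l), ih]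
    simp

theorem slTwoCharacter_eq_zero_of_pow_six {A : Matrix (Fin 2) (Fin 2) (ZMod 3)}
    (hA : A.det = 1) (h : A ^ 6 = -1) : slTwoCharacter A = 0 := by
  have hsq : A ^ 6 = (A * A) * ((A * A) * (A * A)) := by noncomm_ring
  have h00 := congrFun (congrFun (hsq.symm.trans h) 0) 0
  rw [Matrix.det_fin_two] at hA
  simp only [Matrix.mul_apply, Fin.sum_univ_two, Matrix.neg_apply, Matrix.one_apply_eq] at h00
  rw [slTwoCharacter]
  clear h hsq
  generalize A 0 0 = p at *
  generalize A 0 1 = q at *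
  generalize A 1 0 = s at *
  generalize A 1 1 = t at *
  revert p q s t
  decide

/-- If the `r`-fold concatenation of a nonempty finite sequence of positive integers
is an η-sequence, then `r ∈ {1, 2, 3}`. -/
theorem stmt_6 (d : List ℤ) (hd : d ≠ []) (hpos : ∀ x ∈ d, 1 ≤ x)
    (r : ℕ) (hr : 1 ≤ r) (h : IsEtaSeq (List.replicate r d).flatten) :
    r = 1 ∨ r = 2 ∨ r = 3 := by
  have hsum := h.sum_add_six
  have hprod := h.prod_map_etaMatrix
  rw [List.sum_flatten, List.map_replicate, List.sum_replicate, List.length_flatten,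
    List.map_replicate, List.sum_replicate] at hsum
  rw [List.map_flatten, List.prod_flatten, List.map_replicate, List.map_replicate,
    List.prod_replicate] at hprod
  simp only [smul_eq_mul, nsmul_eq_mul, Nat.cast_mul] at hsum
  have hmul : (r : ℤ) * (3 * d.length - d.sum) = 6 := by linarith
  have hdvd : r ∣ 6 := by exact_mod_cast Dvd.intro _ hmul
  have hle : r ≤ 6 := Nat.le_of_dvd (by norm_num) hdvd
  have hr6 : r ≠ 6 := by
    rintro rfl
    have hzero := slTwoCharacter_eq_zero_of_pow_six (det_prod_map_etaMatrix d) hprod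
    rw [slTwoCharacter_prod_map_etaMatrix, ZMod.intCast_zmod_eq_zero_iff_dvd] at hzero
    omega
  interval_cases r <;> omega
end

section
/- Let K be a commutative ring, n ≥ 1, and c_1,…,c_n ∈ K with η(c_n)·η(c_{n−1})⋯η(c_2)·η(c_1) = −Id. For 1 ≤ i ≤ n define the 2×2 matrix σ_i = η(c_i)·τ if i is odd and σ_i = τ·η(c_i) if i is even. Then σ_n·σ_{n−1}⋯σ_2·σ_1 = −τ^n. (In particular, the Weyl groupoid of a connected simply connected rank-two Cartan scheme admitting a finite irreducible root system is a finite reflection groupoid.) -/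
/-- The matrix `τ = [[0, 1], [1, 0]]`. -/
def tau {K : Type*} [CommRing K] : Matrix (Fin 2) (Fin 2) K :=
  !![0, 1; 1, 0]

theorem tau_mul_tau {K : Type*} [CommRing K] :
    (tau : Matrix (Fin 2) (Fin 2) K) * tau = 1 := by
  simp [tau, Matrix.one_fin_two]

/-- The product of alternating reflections is the product of the `η(c_i)`, up to factors `τ`. -/
theorem prod_reflections_eq {K : Type*} [CommRing K] (n : ℕ) (c : ℕ → K) :
    (((List.range n).map (fun j =>
        if Odd (j + 1) then eta (c (j + 1)) * tau else tau * eta (c (j + 1)))).reverse).prod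
      = tau ^ (n + 1) * (((List.range n).map (fun j => eta (c (j + 1)))).reverse).prod * tau := by
  induction n with
  | zero => simp [tau_mul_tau]
  | succ n ih =>
    have hsq : (tau : Matrix (Fin 2) (Fin 2) K) ^ 2 = 1 := by rw [sq, tau_mul_tau]
    simp only [List.range_succ, List.map_append, List.map_cons, List.map_nil,
      List.reverse_append, List.reverse_cons, List.reverse_nil, List.nil_append,
      List.prod_append, List.prod_singleton, ih]
    rcases Nat.even_or_odd' n with ⟨k, rfl | rfl⟩
    · have hodd : Odd (2 * k + 1) := ⟨k, rfl⟩
      have htau : (tau : Matrix (Fin 2) (Fin 2) K) ^ (2 * k) = 1 := by rw [pow_mul, hsq, one_pow]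
      rw [if_pos hodd, pow_succ tau (2 * k + 1), pow_succ tau (2 * k), htau, one_mul, tau_mul_tau,
        one_mul]
      simp only [← mul_assoc]
      rw [mul_assoc (eta _) tau tau, tau_mul_tau, mul_one]
    · have heven : ¬ Odd (2 * k + 1 + 1) := by
        rw [Nat.not_odd_iff_even]
        exact ⟨k + 1, by ring⟩
      have htau : (tau : Matrix (Fin 2) (Fin 2) K) ^ (2 * k + 1 + 1) = 1 := by
        rw [show 2 * k + 1 + 1 = 2 * (k + 1) by ring, pow_mul, hsq, one_pow]
      rw [if_neg heven, pow_succ tau (2 * k + 1 + 1), htau, one_mul, one_mul]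
      simp only [mul_assoc]

/-- If `η(c_n)·η(c_{n-1})⋯η(c_2)·η(c_1) = -Id`, then for the alternating simple
reflections `σ_i = η(c_i)·τ` (`i` odd) and `σ_i = τ·η(c_i)` (`i` even) one has
`σ_n·σ_{n-1}⋯σ_2·σ_1 = -τ^n`. -/
theorem stmt_7 {K : Type*} [CommRing K] (n : ℕ) (hn : 1 ≤ n) (c : ℕ → K)
    (h : (((List.range n).map (fun j => eta (c (j + 1)))).reverse).prod = -1) :
    (((List.range n).map (fun j =>
        if Odd (j + 1) then eta (c (j + 1)) * tau else tau * eta (c (j + 1)))).reverse).prod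
      = -tau ^ n := by
  rw [prod_reflections_eq, h, mul_neg, mul_one, neg_mul, pow_succ, mul_assoc, tau_mul_tau,
    mul_one]
end

section
/- Let K be a field and n ≥ 3. The K-algebra R/J is generated by the images of the n−2 elements c_1, c_2, …, c_{n−2}. -/
open MvPolynomial

/-- The matrix `η(c_n)·η(c_{n-1})⋯η(c_2)·η(c_1)` over `R = K[c_1, …, c_n]`,
where `c_i` is the variable `X ⟨i-1⟩`. -/
noncomputable def etaProdAll (K : Type*) [Field K] (n : ℕ) :
    Matrix (Fin 2) (Fin 2) (MvPolynomial (Fin n) K) :=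
  ((List.ofFn (fun i : Fin n => eta (X i))).reverse).prod

/-- The ideal `J ⊆ R = K[c_1, …, c_n]` generated by the four entries of the matrix
`η(c_n)·η(c_{n-1})⋯η(c_2)·η(c_1) + Id`. -/
noncomputable def Jideal (K : Type*) [Field K] (n : ℕ) :
    Ideal (MvPolynomial (Fin n) K) :=
  Ideal.span (Set.range fun p : Fin 2 × Fin 2 => (etaProdAll K n + 1) p.1 p.2)

/-- The entries of a product of matrices `η(x)` with all `x` in a subring lie in that subring. -/
theorem list_prod_eta_apply_mem {A : Type*} [CommRing A] (S : Subring A) (l : List A)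
    (hl : ∀ x ∈ l, x ∈ S) (i j : Fin 2) : (l.map eta).prod i j ∈ S := by
  have h : (l.map eta).prod ∈ S.matrix := by
    refine list_prod_mem fun M hM => ?_
    obtain ⟨x, hx, rfl⟩ := List.mem_map.1 hM
    intro i j
    fin_cases i <;> fin_cases j <;> simp [eta, hl x hx, S.zero_mem, S.one_mem]
  exact h i j

/-- If `η(a) η(b) P = -1`, then `a` and `b` are up to sign off-diagonal entries of `P`. -/
theorem eq_of_eta_mul_eta_mul_add_one_eq_zero {A : Type*} [CommRing A] (a b : A)
    (P : Matrix (Fin 2) (Fin 2) A) (h : eta a * (eta b * P) + 1 = 0) :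
    a = -P 0 1 ∧ b = P 1 0 := by
  have h₀₀ := congrFun₂ h 0 0
  have h₀₁ := congrFun₂ h 0 1
  have h₁₀ := congrFun₂ h 1 0
  have h₁₁ := congrFun₂ h 1 1
  simp [eta, Matrix.vecMul, dotProduct, Fin.sum_univ_two] at h₀₀ h₀₁ h₁₀ h₁₁
  constructor
  · linear_combination a * h₁₁ - h₀₁
  · linear_combination h₁₀ + b * (h₀₀ - a * h₁₀)

/-- The image of `etaProdAll K n` under a ring homomorphism is the product of the `η`s of the
images of the variables. -/
theorem map_etaProdAll {K A : Type*} [Field K] [CommRing A] {n : ℕ}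
    (φ : MvPolynomial (Fin n) K →+* A) :
    φ.mapMatrix (etaProdAll K n) = ((List.ofFn fun i => φ (X i)).reverse.map eta).prod := by
  have h (x) : φ.mapMatrix (eta x) = eta (φ x) := by
    ext i j
    fin_cases i <;> fin_cases j <;> simp [eta]
  simp [etaProdAll, map_list_prod, List.map_reverse, List.map_ofFn, Function.comp_def, h]

theorem map_mk_etaProdAll_add_one (K : Type*) [Field K] (n : ℕ) :
    (Ideal.Quotient.mk (Jideal K n)).mapMatrix (etaProdAll K n) + 1 = 0 := by
  rw [← map_one (Ideal.Quotient.mk (Jideal K n)).mapMatrix, ← map_add]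
  ext i j
  exact Ideal.Quotient.eq_zero_iff_mem.2 (Ideal.subset_span ⟨(i, j), rfl⟩)

/-- The `K`-algebra `R/J` is generated by the images of `c_1, c_2, …, c_{n-2}`. -/
theorem stmt_10 (K : Type*) [Field K] (n : ℕ) (hn : 3 ≤ n) :
    Algebra.adjoin K
      {x : MvPolynomial (Fin n) K ⧸ Jideal K n |
        ∃ i : Fin n, (i : ℕ) + 2 < n ∧ x = Ideal.Quotient.mk (Jideal K n) (X i)} = ⊤ := by
  obtain ⟨m, rfl⟩ : ∃ m, n = m + 2 := ⟨n - 2, by omega⟩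
  set S := Algebra.adjoin K
      {x : MvPolynomial (Fin (m + 2)) K ⧸ Jideal K (m + 2) |
        ∃ i : Fin (m + 2), (i : ℕ) + 2 < m + 2 ∧
          x = Ideal.Quotient.mk (Jideal K (m + 2)) (X i)}
  set c : Fin (m + 2) → MvPolynomial (Fin (m + 2)) K ⧸ Jideal K (m + 2) :=
    fun i => Ideal.Quotient.mk (Jideal K (m + 2)) (X i)
  have hmem (i : Fin m) : c i.castSucc.castSucc ∈ S :=
    Algebra.subset_adjoin ⟨_, by simp, rfl⟩
  have hP := list_prod_eta_apply_mem S.toSubring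
    (List.ofFn fun i : Fin m => c i.castSucc.castSucc).reverse (by simpa [List.mem_ofFn] using hmem)
  have hprod := map_mk_etaProdAll_add_one K (m + 2)
  rw [map_etaProdAll, List.ofFn_succ', List.ofFn_succ'] at hprod
  simp only [List.concat_eq_append, List.reverse_append, List.reverse_singleton,
    List.singleton_append, List.map_cons, List.prod_cons] at hprod
  obtain ⟨ha, hb⟩ := eq_of_eta_mul_eta_mul_add_one_eq_zero _ _ _ hprod
  have hall (i : Fin (m + 2)) : c i ∈ S := by
    induction i using Fin.lastCases with
    | last => exact (congrArg (· ∈ S) ha).mpr (S.neg_mem (hP 0 1))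
    | cast i =>
      induction i using Fin.lastCases with
      | last => exact (congrArg (· ∈ S) hb).mpr (hP 1 0)
      | cast i => exact hmem i
  rw [eq_top_iff]
  rintro x -
  obtain ⟨p, rfl⟩ := Ideal.Quotient.mk_surjective x
  induction p using MvPolynomial.induction_on with
  | C r => exact S.algebraMap_mem r
  | add p q hp hq => simpa only [map_add] using S.add_mem hp hq
  | mul_X p i hp => simpa only [map_mul] using S.mul_mem hp (hall i)
end

section
/- For all elements f_1, f_2, f_3, a, b, c, d of a commutative ring K, the following identity of 2×2 matrices holds: f_2 · μ(f_1,a,b)·μ(f_2,b,c)·μ(f_3,c,d) = μ(f_1·f_2 − a·c, a·b, b·f_2)·μ(f_2·f_3 − b·d, c·f_2, c·d). -/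
/-- The matrix `μ(a,b,c) = [[a, -b], [c, 0]]`. -/
def mu {K : Type*} [CommRing K] (a b c : K) : Matrix (Fin 2) (Fin 2) K :=
  !![a, -b; c, 0]

/-- `f₂ · μ(f₁,a,b)·μ(f₂,b,c)·μ(f₃,c,d)
      = μ(f₁f₂ - ac, ab, bf₂)·μ(f₂f₃ - bd, cf₂, cd)`. -/
theorem stmt_11 {K : Type*} [CommRing K] (f₁ f₂ f₃ a b c d : K) :
    f₂ • (mu f₁ a b * mu f₂ b c * mu f₃ c d) =
      mu (f₁ * f₂ - a * c) (a * b) (b * f₂) * mu (f₂ * f₃ - b * d) (c * f₂) (c * d) := by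
  ext i j
  fin_cases i <;> fin_cases j <;>
    simp [mu, Matrix.mul_apply, Fin.sum_univ_two] <;> ring
end

section
/- Let K be a commutative ring, n ≥ 3, and c_1,…,c_n ∈ K with η(c_n)·η(c_{n−1})⋯η(c_2)·η(c_1) = −Id. Then there exists a 2×n matrix z = (z_{ij}) with entries in K such that its 2×2 minors D(i,j) := z_{1i}·z_{2j} − z_{1j}·z_{2i} satisfy: D(i,i+1) = 1 for i = 1,…,n−1; D(n,1) = −1; D(i,i+2) = c_i for i = 1,…,n−2; D(n−1,1) = −c_{n−1}; and D(n,2) = −c_n. -/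
/-- The product `η(c_k)⋯η(c_1)`. -/
def etaProd {K : Type*} [CommRing K] (c : ℕ → K) (k : ℕ) : Matrix (Fin 2) (Fin 2) K :=
  (((List.range k).map (fun m => eta (c (m + 1)))).reverse).prod

section etaProd

variable {K : Type*} [CommRing K] (c : ℕ → K) (k : ℕ)

theorem etaProd_zero : etaProd c 0 = 1 := by
  simp [etaProd]

theorem etaProd_succ : etaProd c (k + 1) = eta (c (k + 1)) * etaProd c k := by
  simp [etaProd, List.range_succ]

theorem det_etaProd : (etaProd c k).det = 1 := by
  induction k with
  | zero => simp [etaProd_zero]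
  | succ k ih => rw [etaProd_succ, Matrix.det_mul, ih]; simp [eta, Matrix.det_fin_two]

theorem etaProd_succ_one (j : Fin 2) : etaProd c (k + 1) 1 j = etaProd c k 0 j := by
  simp [etaProd_succ, eta, Matrix.mul_apply, Fin.sum_univ_two]

theorem etaProd_succ_zero (j : Fin 2) :
    etaProd c (k + 1) 0 j = c (k + 1) * etaProd c k 0 j - etaProd c k 1 j := by
  simp [etaProd_succ, eta, Matrix.mul_apply, Fin.sum_univ_two, sub_eq_add_neg]

theorem etaProd_minor_succ :
    etaProd c k 1 1 * etaProd c (k + 1) 1 0 - etaProd c (k + 1) 1 1 * etaProd c k 1 0 = 1 := by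
  have hdet := det_etaProd c k
  rw [Matrix.det_fin_two] at hdet
  rw [etaProd_succ_one, etaProd_succ_one]
  linear_combination hdet

theorem etaProd_minor_add_two :
    etaProd c k 1 1 * etaProd c (k + 2) 1 0 - etaProd c (k + 2) 1 1 * etaProd c k 1 0 =
      c (k + 1) := by
  have hdet := det_etaProd c k
  rw [Matrix.det_fin_two] at hdet
  rw [etaProd_succ_one, etaProd_succ_one, etaProd_succ_zero, etaProd_succ_zero]
  linear_combination c (k + 1) * hdet

end etaProd

/-- If `η(c_n)·η(c_{n-1})⋯η(c_2)·η(c_1) = -Id`, then there is a `2 × n` matrix,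
given by its rows `z₁, z₂`, whose `2 × 2` minors
`D(i,j) = z₁ᵢ·z₂ⱼ − z₁ⱼ·z₂ᵢ` satisfy `D(i,i+1) = 1` for `i = 1,…,n-1`, `D(n,1) = -1`,
`D(i,i+2) = cᵢ` for `i = 1,…,n-2`, `D(n-1,1) = -c_{n-1}` and `D(n,2) = -c_n`. -/
theorem stmt_15 {K : Type*} [CommRing K] (n : ℕ) (hn : 3 ≤ n) (c : ℕ → K)
    (h : (((List.range n).map (fun m => eta (c (m + 1)))).reverse).prod = -1) :
    ∃ z₁ z₂ : ℕ → K,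
      (∀ i, 1 ≤ i → i + 1 ≤ n → z₁ i * z₂ (i + 1) - z₁ (i + 1) * z₂ i = 1) ∧
      (z₁ n * z₂ 1 - z₁ 1 * z₂ n = -1) ∧
      (∀ i, 1 ≤ i → i + 2 ≤ n → z₁ i * z₂ (i + 2) - z₁ (i + 2) * z₂ i = c i) ∧
      (z₁ (n - 1) * z₂ 1 - z₁ 1 * z₂ (n - 1) = -c (n - 1)) ∧
      (z₁ n * z₂ 2 - z₁ 2 * z₂ n = -c n) := by
  obtain ⟨m, rfl⟩ : ∃ m, n = m + 2 := ⟨n - 2, by omega⟩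
  have hP : etaProd c (m + 2) = -1 := h
  have h₁ (j : Fin 2) : etaProd c (m + 2) 1 j = -etaProd c 0 1 j := by
    rw [hP, etaProd_zero, Matrix.neg_apply]
  have h₂ (j : Fin 2) : etaProd c (m + 3) 1 j = -etaProd c 1 1 j := by
    rw [etaProd_succ_one, etaProd_succ_one, hP, etaProd_zero, Matrix.neg_apply]
  refine ⟨fun i => etaProd c (i - 1) 1 1, fun i => etaProd c (i - 1) 1 0, ?_, ?_, ?_, ?_, ?_⟩
  · rintro (_ | i) hi -
    · omega
    · exact etaProd_minor_succ c i
  · have hD := etaProd_minor_succ c (m + 1)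
    rw [h₁, h₁] at hD
    change etaProd c (m + 1) 1 1 * etaProd c 0 1 0 - etaProd c 0 1 1 * etaProd c (m + 1) 1 0 = -1
    linear_combination -hD
  · rintro (_ | i) hi -
    · omega
    · exact etaProd_minor_add_two c i
  · have hD := etaProd_minor_add_two c m
    rw [h₁, h₁] at hD
    change etaProd c m 1 1 * etaProd c 0 1 0 - etaProd c 0 1 1 * etaProd c m 1 0 = -c (m + 1)
    linear_combination -hD
  · have hD := etaProd_minor_add_two c (m + 1)
    rw [h₂, h₂] at hD
    change etaProd c (m + 1) 1 1 * etaProd c 1 1 0 - etaProd c 1 1 1 * etaProd c (m + 1) 1 0 =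
      -c (m + 2)
    linear_combination -hD
end
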